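/- For 1 ≤ ℓ ≤ L let (F^{(ℓ)}_{i^{(ℓ)}})_{i^{(ℓ)}∈ℤ^{d_ℓ}} be completely commuting filtrations on a common probability space (Ω,F,P), and suppose that for every choice of indices i^{(1)}∈ℤ^{d_1},…,i^{(L)}∈ℤ^{d_L} the σ-algebras F^{(1)}_{i^{(1)}},…,F^{(L)}_{i^{(L)}} are independent. Let d = d_1+⋯+d_L and for i = (i^{(1)},…,i^{(L)}) ∈ ℤ^d set F_i = ⋁_{ℓ=1}^L F^{(ℓ)}_{i^{(ℓ)}}. Then (F_i)_{i∈ℤ^d} is a completely commuting filtration. -/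

import Mathlib

open MeasureTheory ProbabilityTheory

noncomputable section

/-- A completely commuting filtration indexed by a lattice (for `ℤ^d` with the
coordinatewise order, the infimum `i ⊓ j` is the coordinatewise minimum). -/
def IsCompletelyCommuting {Ω : Type*} {ι : Type*} [Lattice ι] [m0 : MeasurableSpace Ω]
    (μ : Measure Ω) (F : ι → MeasurableSpace Ω) : Prop :=
  (∀ i, F i ≤ m0) ∧ Monotone F ∧
    ∀ Y : Ω → ℝ, Integrable Y μ →
      ∀ i j : ι, μ[μ[Y | F i] | F j] =ᵐ[μ] μ[Y | F (i ⊓ j)]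

/-- Two integrable functions whose integrals agree on all finite intersections of sets, one from
each of finitely many σ-algebras, have the same integrals on all sets of their supremum. -/
lemma setIntegral_eq_of_forall_iInter {Ω ι E : Type*} [Fintype ι] [NormedAddCommGroup E]
    [NormedSpace ℝ E] {m0 : MeasurableSpace Ω} {μ : Measure Ω} {m : ι → MeasurableSpace Ω}
    (hm : ∀ i, m i ≤ m0) {f g : Ω → E} (hf : Integrable f μ) (hg : Integrable g μ)
    (h : ∀ S : ι → Set Ω, (∀ i, MeasurableSet[m i] (S i)) →
      ∫ x in ⋂ i, S i, f x ∂μ = ∫ x in ⋂ i, S i, g x ∂μ)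
    {T : Set Ω} (hT : MeasurableSet[⨆ i, m i] T) :
    ∫ x in T, f x ∂μ = ∫ x in T, g x ∂μ := by
  classical
  have hle : ⨆ i, m i ≤ m0 := iSup_le hm
  have hgen : ⨆ i, m i = MeasurableSpace.generateFrom
      (piiUnionInter (fun i => {s | MeasurableSet[m i] s}) Set.univ) := by
    rw [generateFrom_piiUnionInter_measurableSet m Set.univ]
    simp
  have huniv : ∫ x, f x ∂μ = ∫ x, g x ∂μ := by
    simpa using h (fun _ => Set.univ) (fun _ => MeasurableSet.univ)
  induction T, hT using MeasurableSpace.induction_on_inter hgen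
    (isPiSystem_piiUnionInter _ (fun i => @MeasurableSpace.isPiSystem_measurableSet Ω (m i)) _) with
  | empty => simp
  | basic t ht =>
    obtain ⟨s, -, S, hS, rfl⟩ := ht
    have hST : ⋂ i ∈ s, S i = ⋂ i, if i ∈ s then S i else Set.univ := by
      ext x
      simp only [Set.mem_iInter]
      refine forall_congr' fun i => ?_
      by_cases hi : i ∈ s <;> simp [hi]
    rw [hST]
    refine h _ fun i => ?_
    by_cases hi : i ∈ s
    · simpa [hi] using hS i hi
    · simp [hi]
  | compl t ht ih =>
    rw [setIntegral_compl (hle _ ht) hf, setIntegral_compl (hle _ ht) hg, ih, huniv]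
  | iUnion t hd ht ih =>
    rw [integral_iUnion (fun n => hle _ (ht n)) hd hf.integrableOn,
      integral_iUnion (fun n => hle _ (ht n)) hd hg.integrableOn]
    simp_rw [ih]

/-- Conditional expectations of indicators of sets are bounded by one. -/
lemma ae_norm_condExp_indicator_one_le {Ω : Type*} {m m0 : MeasurableSpace Ω} (μ : Measure Ω)
    (T : Set Ω) : ∀ᵐ x ∂μ, ‖(μ[T.indicator (fun _ => (1 : ℝ)) | m]) x‖ ≤ 1 := by
  refine ae_bdd_abs_condExp_of_ae_bdd_abs (R := 1) (ae_of_all _ fun x => ?_)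
  by_cases hx : x ∈ T <;> simp [hx]

/-- If `m i ≤ D i` and the σ-algebras `D i` are independent, the conditional probability given
`⨆ i, m i` of an intersection of `D i`-measurable sets is the product of the conditional
probabilities given `m i`. -/
lemma condExp_indicator_iInter_eq_prod {Ω ι : Type*} [Fintype ι] {m0 : MeasurableSpace Ω}
    {μ : Measure Ω} [IsProbabilityMeasure μ] {m D : ι → MeasurableSpace Ω}
    (hmD : ∀ i, m i ≤ D i) (hD : ∀ i, D i ≤ m0) (hindep : iIndep D μ)
    {T : ι → Set Ω} (hT : ∀ i, MeasurableSet[D i] (T i)) :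
    μ[(⋂ i, T i).indicator (fun _ => (1 : ℝ)) | ⨆ i, m i] =ᵐ[μ]
      fun x => ∏ i, (μ[(T i).indicator (fun _ => (1 : ℝ)) | m i]) x := by
  have hm : ∀ i, m i ≤ m0 := fun i => (hmD i).trans (hD i)
  have hle : ⨆ i, m i ≤ m0 := iSup_le hm
  have hTint : ∀ i, Integrable ((T i).indicator (fun _ => (1 : ℝ))) μ :=
    fun i => (integrable_const 1).indicator (hD i _ (hT i))
  have hint : Integrable ((⋂ i, T i).indicator (fun _ => (1 : ℝ))) μ :=
    (integrable_const 1).indicator (MeasurableSet.iInter fun i => hD i _ (hT i))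
  set g : ι → Ω → ℝ := fun i => μ[(T i).indicator (fun _ => (1 : ℝ)) | m i]
  have hgm : ∀ i, StronglyMeasurable[m i] (g i) := fun i => stronglyMeasurable_condExp
  have hprodm : StronglyMeasurable[⨆ i, m i] (fun x => ∏ i, g i x) :=
    Finset.stronglyMeasurable_fun_prod _ fun i _ => (hgm i).mono (le_iSup m i)
  have hprodint : Integrable (fun x => ∏ i, g i x) μ := by
    refine Integrable.of_bound (hprodm.mono hle).aestronglyMeasurable 1 ?_
    filter_upwards [ae_all_iff.2 fun i => ae_norm_condExp_indicator_one_le (m := m i) μ (T i)]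
      with x hx
    rw [norm_prod]
    exact Finset.prod_le_one (fun _ _ => norm_nonneg _) fun i _ => hx i
  -- integrals of products of `D i`-measurable functions factorize
  have hfac : ∀ f : ι → Ω → ℝ, (∀ i, Measurable[D i] (f i)) →
      ∫ x, ∏ i, f i x ∂μ = ∏ i, ∫ x, f i x ∂μ := by
    intro f hf
    refine iIndepFun.integral_fun_prod_eq_prod_integral ?_
      fun i => ((hf i).mono (hD i) le_rfl).aestronglyMeasurable
    exact iIndep_of_iIndep_of_le hindep fun i => (hf i).comap_le
  refine (ae_eq_condExp_of_forall_setIntegral_eq hle hint (fun _ _ _ => hprodint.integrableOn)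
    (fun s hs _ => setIntegral_eq_of_forall_iInter hm hprodint hint (fun S hS => ?_) hs)
    hprodm.aestronglyMeasurable).symm
  have hSD : ∀ i, MeasurableSet[D i] (S i) := fun i => hmD i _ (hS i)
  have hSmeas : MeasurableSet (⋂ i, S i) := MeasurableSet.iInter fun i => hD i _ (hSD i)
  have hind : ∀ f : ι → Ω → ℝ, (⋂ i, S i).indicator (fun x => ∏ i, f i x) =
      fun x => ∏ i, (S i).indicator (f i) x := by
    intro f
    ext x
    by_cases hx : x ∈ ⋂ i, S i
    · rw [Set.indicator_of_mem hx]
      exact Finset.prod_congr rfl fun i _ =>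
        (Set.indicator_of_mem (Set.mem_iInter.1 hx i) _).symm
    · obtain ⟨i, hi⟩ := not_forall.1 (mt Set.mem_iInter.2 hx)
      rw [Set.indicator_of_notMem hx,
        Finset.prod_eq_zero (Finset.mem_univ i) (Set.indicator_of_notMem hi _)]
  have hTind : (⋂ i, T i).indicator (fun _ => (1 : ℝ)) =
      fun x => ∏ i, (T i).indicator (fun _ => (1 : ℝ)) x := by
    ext x
    by_cases hx : x ∈ ⋂ i, T i
    · rw [Set.indicator_of_mem hx]
      exact (Finset.prod_eq_one fun i _ => Set.indicator_of_mem (Set.mem_iInter.1 hx i) _).symm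
    · obtain ⟨i, hi⟩ := not_forall.1 (mt Set.mem_iInter.2 hx)
      rw [Set.indicator_of_notMem hx,
        Finset.prod_eq_zero (Finset.mem_univ i) (Set.indicator_of_notMem hi _)]
  rw [hTind, ← integral_indicator hSmeas, ← integral_indicator hSmeas, hind, hind,
    hfac _ fun i => ((hgm i).measurable.mono (hmD i) le_rfl).indicator (hSD i),
    hfac _ fun i => (measurable_const.indicator (hT i)).indicator (hSD i)]
  refine Finset.prod_congr rfl fun i _ => ?_
  rw [integral_indicator (hD i _ (hSD i)), integral_indicator (hD i _ (hSD i))]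
  exact setIntegral_condExp (hm i) (hTint i) (hS i)

/-- Conditional expectation is self-adjoint, tested against indicators. -/
lemma setIntegral_condExp_eq_integral_mul {Ω : Type*} {m m0 : MeasurableSpace Ω}
    {μ : Measure Ω} [IsFiniteMeasure μ] (hm : m ≤ m0) {Y : Ω → ℝ} (hY : Integrable Y μ)
    {T : Set Ω} (hT : MeasurableSet T) :
    ∫ x in T, (μ[Y | m]) x ∂μ = ∫ x, (μ[T.indicator (fun _ => (1 : ℝ)) | m]) x * Y x ∂μ := by
  have h1 : Integrable (T.indicator fun _ => (1 : ℝ)) μ := (integrable_const 1).indicator hT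
  have hTY : μ[Y | m] * T.indicator (fun _ => (1 : ℝ)) = T.indicator (μ[Y | m]) := by
    ext x
    by_cases hx : x ∈ T <;> simp [hx]
  have hleft : μ[μ[Y | m] * T.indicator (fun _ => (1 : ℝ)) | m] =ᵐ[μ]
      μ[Y | m] * μ[T.indicator (fun _ => (1 : ℝ)) | m] :=
    condExp_mul_of_stronglyMeasurable_left stronglyMeasurable_condExp
      (hTY ▸ integrable_condExp.indicator hT) h1
  have hright : μ[μ[T.indicator (fun _ => (1 : ℝ)) | m] * Y | m] =ᵐ[μ]
      μ[T.indicator (fun _ => (1 : ℝ)) | m] * μ[Y | m] :=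
    condExp_stronglyMeasurable_mul_of_bound hm stronglyMeasurable_condExp hY 1
      (ae_norm_condExp_indicator_one_le μ T)
  calc ∫ x in T, (μ[Y | m]) x ∂μ
      = ∫ x, (μ[Y | m] * T.indicator (fun _ => (1 : ℝ))) x ∂μ := by
        rw [hTY, integral_indicator hT]
    _ = ∫ x, (μ[Y | m] * μ[T.indicator (fun _ => (1 : ℝ)) | m]) x ∂μ := by
        rw [← integral_condExp hm]
        exact integral_congr_ae hleft
    _ = ∫ x, (μ[T.indicator (fun _ => (1 : ℝ)) | m] * Y) x ∂μ := by
        rw [mul_comm, ← integral_congr_ae hright, integral_condExp hm]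

/-- If `(F^{(ℓ)})`, `1 ≤ ℓ ≤ L`, are completely commuting filtrations indexed by
`ℤ^{d_ℓ}` which are independent (for every choice of indices), then the filtration
indexed by `ℤ^{d_1} × ⋯ × ℤ^{d_L} ≅ ℤ^{d_1 + ⋯ + d_L}` (with the coordinatewise order)
given by `F_i = ⋁_ℓ F^{(ℓ)}_{i^{(ℓ)}}` is completely commuting. -/
theorem statement1 {Ω : Type*} [m0 : MeasurableSpace Ω]
    (μ : Measure Ω) [IsProbabilityMeasure μ]
    {L : ℕ} (d : Fin L → ℕ)
    (F : ∀ ℓ : Fin L, (Fin (d ℓ) → ℤ) → MeasurableSpace Ω)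
    (hcc : ∀ ℓ, IsCompletelyCommuting μ (F ℓ))
    (hindep : ∀ i : ∀ ℓ, (Fin (d ℓ) → ℤ), iIndep (fun ℓ => F ℓ (i ℓ)) μ) :
    IsCompletelyCommuting μ
      (fun i : ∀ ℓ : Fin L, (Fin (d ℓ) → ℤ) => ⨆ ℓ, F ℓ (i ℓ)) := by
  have hle : ∀ ℓ i, F ℓ i ≤ m0 := fun ℓ => (hcc ℓ).1
  have hmono : ∀ ℓ, Monotone (F ℓ) := fun ℓ => (hcc ℓ).2.1
  have hsup_le : ∀ i : ∀ ℓ, (Fin (d ℓ) → ℤ), ⨆ ℓ, F ℓ (i ℓ) ≤ m0 :=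
    fun i => iSup_le fun ℓ => hle ℓ (i ℓ)
  have hsup_mono : Monotone fun i : ∀ ℓ, (Fin (d ℓ) → ℤ) => ⨆ ℓ, F ℓ (i ℓ) :=
    fun i j hij => iSup_mono fun ℓ => hmono ℓ (hij ℓ)
  refine ⟨hsup_le, hsup_mono, fun Y hY i j => ?_⟩
  refine (ae_eq_condExp_of_forall_setIntegral_eq (hsup_le j) integrable_condExp
    (fun _ _ _ => integrable_condExp.integrableOn)
    (fun s hs _ => setIntegral_eq_of_forall_iInter (fun ℓ => hle ℓ (j ℓ)) integrable_condExp
      integrable_condExp (fun T hT => ?_) hs)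
    (stronglyMeasurable_condExp.mono (hsup_mono inf_le_right)).aestronglyMeasurable).symm
  have hTm : ∀ ℓ, MeasurableSet (T ℓ) := fun ℓ => hle ℓ _ _ (hT ℓ)
  have hTD : ∀ ℓ, MeasurableSet[F ℓ ((i ⊔ j) ℓ)] (T ℓ) :=
    fun ℓ => hmono ℓ (le_sup_right (a := i ℓ)) _ (hT ℓ)
  have hfactor : ∀ ℓ, μ[(T ℓ).indicator (fun _ => (1 : ℝ)) | F ℓ ((i ⊓ j) ℓ)] =ᵐ[μ]
      μ[(T ℓ).indicator (fun _ => (1 : ℝ)) | F ℓ (i ℓ)] := by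
    intro ℓ
    have hint : Integrable ((T ℓ).indicator fun _ => (1 : ℝ)) μ :=
      (integrable_const 1).indicator (hTm ℓ)
    have h := (hcc ℓ).2.2 _ hint (j ℓ) (i ℓ)
    rw [condExp_of_stronglyMeasurable (hle ℓ (j ℓ))
      (stronglyMeasurable_const.indicator (hT ℓ)) hint, inf_comm] at h
    exact h.symm
  have hbox : μ[(⋂ ℓ, T ℓ).indicator (fun _ => (1 : ℝ)) | ⨆ ℓ, F ℓ ((i ⊓ j) ℓ)] =ᵐ[μ]
      μ[(⋂ ℓ, T ℓ).indicator (fun _ => (1 : ℝ)) | ⨆ ℓ, F ℓ (i ℓ)] := by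
    refine (condExp_indicator_iInter_eq_prod (fun ℓ => hmono ℓ (inf_le_left.trans le_sup_left))
      (fun ℓ => hle ℓ _) (hindep (i ⊔ j)) hTD).trans (Filter.EventuallyEq.trans ?_
      (condExp_indicator_iInter_eq_prod (fun ℓ => hmono ℓ le_sup_left)
        (fun ℓ => hle ℓ _) (hindep (i ⊔ j)) hTD).symm)
    filter_upwards [ae_all_iff.2 hfactor] with x hx
    exact Finset.prod_congr rfl fun ℓ _ => hx ℓ
  rw [setIntegral_condExp_eq_integral_mul (hsup_le _) hY (MeasurableSet.iInter hTm),
    setIntegral_condExp_eq_integral_mul (hsup_le _) hY (MeasurableSet.iInter hTm)]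
  exact integral_congr_ae (hbox.mul (Filter.EventuallyEq.refl _ Y))

end
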